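/- arXiv:1403.4405 — 5 statements merged into one kernel-verified Lean document; each statement's English description precedes it below -/
import Mathlib

section
/- Let (P, G, B) be a transversal design TD(k, n) with k = 3 or k = 4, and let A ⊆ B be an absorbing set, i.e., A is nonempty and every block B ∈ A satisfies 2·|{p ∈ B : deg_A(p) is odd}| < k. Then A is fully absorbing — i.e., every block B ∈ B ∖ A also satisfies 2·|{p ∈ B : deg_A(p) is odd}| < k — if and only if all points of odd degree lie in a single group, i.e., there exists a group g ∈ G with O(A) ⊆ g. -/
/-- A transversal design `TD(k, n)`: a set `P` of `k·n` points partitioned (via the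
group-assignment map `grp`) into `k` groups of size `n`, together with a collection of
`k`-element blocks such that every pair of distinct points from different groups lies in
exactly one block, and every pair of distinct points from the same group lies in no block. -/
structure TransversalDesign (P : Type*) [Fintype P] [DecidableEq P] (k n : ℕ) where
  grp : P → Fin k
  card_points : Fintype.card P = k * n
  card_group : ∀ g : Fin k, (Finset.univ.filter fun p => grp p = g).card = n
  blocks : Finset (Finset P)
  card_block : ∀ B ∈ blocks, B.card = k
  pair_diff : ∀ p q : P, p ≠ q → grp p ≠ grp q → ∃! B, B ∈ blocks ∧ p ∈ B ∧ q ∈ B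
  pair_same : ∀ p q : P, p ≠ q → grp p = grp q → ∀ B ∈ blocks, ¬(p ∈ B ∧ q ∈ B)

/-- The degree of a point `p` with respect to a collection `A` of blocks: the number of
blocks of `A` containing `p`. -/
def blockDegree {P : Type*} [DecidableEq P] (A : Finset (Finset P)) (p : P) : ℕ :=
  (A.filter fun B => p ∈ B).card

/-- Let `(P,G,B)` be a `TD(k,n)` with `k = 3` or `k = 4`, and let
`A ⊆ B` be an absorbing set (nonempty, and every block of `A` has
`2·|{p ∈ B : deg_A(p) odd}| < k`). Then `A` is fully absorbing (every block outside `A`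
also satisfies this inequality) if and only if all points of odd degree lie in a single
group. -/
theorem td_fully_absorbing_iff_odd_points_in_one_group
    {P : Type*} [Fintype P] [DecidableEq P] {k n : ℕ}
    (D : TransversalDesign P k n) (hk : k = 3 ∨ k = 4)
    (A : Finset (Finset P)) (hA : A ⊆ D.blocks) (hne : A.Nonempty)
    (habs : ∀ B ∈ A, 2 * (B.filter fun p => Odd (blockDegree A p)).card < k) :
    (∀ B ∈ D.blocks, B ∉ A →
        2 * (B.filter fun p => Odd (blockDegree A p)).card < k)
      ↔ ∃ g : Fin k, ∀ p : P, Odd (blockDegree A p) → D.grp p = g := by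
  have two_mul_lt_iff (m : ℕ) : 2 * m < k ↔ m ≤ 1 := by omega
  simp only [two_mul_lt_iff, Finset.card_le_one, Finset.mem_filter] at habs ⊢
  constructor
  · intro hfull
    by_cases hodd : ∃ p, Odd (blockDegree A p)
    · obtain ⟨p, hp⟩ := hodd
      refine ⟨D.grp p, fun q hq => ?_⟩
      by_contra hqp
      have hne' : q ≠ p := fun h => hqp (congrArg D.grp h)
      obtain ⟨B, ⟨hB, hqB, hpB⟩, -⟩ := D.pair_diff q p hne' hqp
      by_cases hBA : B ∈ A
      · exact hne' (habs B hBA q ⟨hqB, hq⟩ p ⟨hpB, hp⟩)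
      · exact hne' (hfull B hB hBA q ⟨hqB, hq⟩ p ⟨hpB, hp⟩)
    · exact ⟨⟨0, by omega⟩, fun p hp => absurd ⟨p, hp⟩ hodd⟩
  · rintro ⟨g, hg⟩ B hB - p ⟨hpB, hp⟩ q ⟨hqB, hq⟩
    by_contra hpq
    exact D.pair_same p q hpq ((hg p hp).trans (hg q hq).symm) B hB ⟨hpB, hqB⟩
end

section
/- Let F be a field and let α_1, α_2 ∈ F satisfy 2·α_1 ≠ α_2. Suppose p_1, …, p_{10} ∈ F satisfy the eight equations α_1·p_1 + p_4 − p_2 = 0, α_2·p_1 + p_4 − p_3 = 0, α_1·p_1 + p_5 − p_6 = 0, α_2·p_1 + p_5 − p_7 = 0, α_1·p_8 + p_5 − p_2 = 0, α_2·p_8 + p_5 − p_9 = 0, α_1·p_8 + p_{10} − p_6 = 0, and α_2·p_8 + p_{10} − p_3 = 0. Then p_1 = p_8 and p_3 = p_9; in particular, every solution of the system is degenerate, so the corresponding (4,4) absorbing set of this type cannot occur. -/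
/-- In a field `F` with `2·α₁ ≠ α₂`, every solution of the linear
system characterizing a `(4,4)` absorbing set of type `((P,B), φ₁)` with colour-to-group
mapping `π₅` satisfies `p₁ = p₈` and `p₃ = p₉`; in particular every solution is
degenerate, so the corresponding absorbing set cannot occur. -/
theorem absorbing_set_44_system_degenerate {F : Type*} [Field F]
    (α₁ α₂ p₁ p₂ p₃ p₄ p₅ p₆ p₇ p₈ p₉ p₁₀ : F)
    (h : 2 * α₁ ≠ α₂)
    (e₁ : α₁ * p₁ + p₄ - p₂ = 0) (e₂ : α₂ * p₁ + p₄ - p₃ = 0)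
    (e₃ : α₁ * p₁ + p₅ - p₆ = 0) (e₄ : α₂ * p₁ + p₅ - p₇ = 0)
    (e₅ : α₁ * p₈ + p₅ - p₂ = 0) (e₆ : α₂ * p₈ + p₅ - p₉ = 0)
    (e₇ : α₁ * p₈ + p₁₀ - p₆ = 0) (e₈ : α₂ * p₈ + p₁₀ - p₃ = 0) :
    p₁ = p₈ ∧ p₃ = p₉ := by
  have hp : p₁ = p₈ := by
    have hmul : (2 * α₁ - α₂) * (p₁ - p₈) = 0 := by
      linear_combination e₁ - e₅ + e₃ - e₇ - e₂ + e₈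
    exact sub_eq_zero.mp ((mul_eq_zero.mp hmul).resolve_left (sub_ne_zero.mpr h))
  subst hp
  exact ⟨rfl, by linear_combination e₆ - e₂ + e₁ - e₅⟩
end

section
/- Let F_q be a finite field with char F_q ≠ 2, and let α_1, α_2 be distinct nonzero elements of F_q satisfying α_1 + α_2 ≠ 0, 2·α_1 − α_2 ≠ 0, and α_1 − 2·α_2 ≠ 0. Then the L_q^2-TD contains no (4,4) absorbing set configuration: there do not exist four pairwise distinct blocks B_1, B_2, B_3, B_4 such that every two of them intersect in exactly one point and the six pairwise intersection points are pairwise distinct. -/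
/-- The block `B(x,y)` of the `𝓛_q^2`-TD with scale factors `α₁, α₂`:
`B(x,y) = {(x,1), (y,2), (α₁·x+y,3), (α₂·x+y,4)}`, the four groups being indexed
by `Fin 4`. -/
def blk4 {F : Type*} [Field F] (α₁ α₂ : F) (xy : F × F) : Set (F × Fin 4) :=
  {(xy.1, (0 : Fin 4)), (xy.2, (1 : Fin 4)),
   (α₁ * xy.1 + xy.2, (2 : Fin 4)), (α₂ * xy.1 + xy.2, (3 : Fin 4))}

/-- The coefficients of the linear form on `F × F` whose level sets are the blocks through
the points of group `c`. -/
def groupCoeff {F : Type*} [Field F] (α₁ α₂ : F) (c : Fin 4) : F × F :=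
  ![(1, 0), (0, 1), (α₁, 1), (α₂, 1)] c

/-- The first coordinate of the point of group `c` on the block with parameters `P`. -/
def groupForm {F : Type*} [Field F] (α₁ α₂ : F) (c : Fin 4) (P : F × F) : F :=
  (groupCoeff α₁ α₂ c).1 * P.1 + (groupCoeff α₁ α₂ c).2 * P.2

/-- The determinant of the linear forms of two groups. -/
def groupDet {F : Type*} [Field F] (α₁ α₂ : F) (c d : Fin 4) : F :=
  (groupCoeff α₁ α₂ c).1 * (groupCoeff α₁ α₂ d).2 -
    (groupCoeff α₁ α₂ c).2 * (groupCoeff α₁ α₂ d).1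

theorem mem_blk4_iff {F : Type*} [Field F] (α₁ α₂ : F) (P : F × F) (p : F × Fin 4) :
    p ∈ blk4 α₁ α₂ P ↔ p.1 = groupForm α₁ α₂ p.2 P := by
  obtain ⟨z, c⟩ := p
  fin_cases c <;> simp [blk4, groupForm, groupCoeff]

theorem groupDet_ne_zero {F : Type*} [Field F] {α₁ α₂ : F} (hα₁ : α₁ ≠ 0) (hα₂ : α₂ ≠ 0)
    (hne : α₁ ≠ α₂) {c d : Fin 4} (hcd : c ≠ d) : groupDet α₁ α₂ c d ≠ 0 := by
  fin_cases c <;> fin_cases d <;>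
    simp_all [groupDet, groupCoeff, sub_eq_zero, eq_comm]

/-- No group pair `e, f` is in harmonic position with respect to a disjoint pair `a, d`. -/
theorem groupDet_harmonic_ne_zero {F : Type*} [Field F] {α₁ α₂ : F} (hα₁ : α₁ ≠ 0)
    (hα₂ : α₂ ≠ 0) (hne : α₁ ≠ α₂) (h2 : (2 : F) ≠ 0)
    (hC1 : α₁ + α₂ ≠ 0) (hC2 : 2 * α₁ - α₂ ≠ 0) (hC3 : α₁ - 2 * α₂ ≠ 0)
    {a d e f : Fin 4} (had : a ≠ d) (hea : e ≠ a) (hed : e ≠ d) (hfa : f ≠ a) (hfd : f ≠ d) :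
    groupDet α₁ α₂ e d * groupDet α₁ α₂ a f + groupDet α₁ α₂ a e * groupDet α₁ α₂ f d ≠ 0 := by
  by_cases hef : e = f
  · subst hef
    have hprod := mul_ne_zero h2 (mul_ne_zero (groupDet_ne_zero hα₁ hα₂ hne hed)
      (groupDet_ne_zero hα₁ hα₂ hne hea.symm))
    intro h
    exact hprod (by linear_combination h)
  · fin_cases a <;> fin_cases d <;> first | exact absurd rfl had | skip
    all_goals fin_cases e <;> first | exact absurd rfl hea | exact absurd rfl hed | skip
    all_goals
      fin_cases f <;>
        first
        | exact absurd rfl hfa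
        | exact absurd rfl hfd
        | exact absurd rfl hef
        | (simp [groupDet, groupCoeff]; grind)

/-- A parallelogram with sides in groups `a`, `d` and diagonals in groups `e`, `f` is
degenerate. -/
theorem eq_of_parallelogram {F : Type*} [Field F] {α₁ α₂ : F} (hα₁ : α₁ ≠ 0)
    (hα₂ : α₂ ≠ 0) (hne : α₁ ≠ α₂) (h2 : (2 : F) ≠ 0)
    (hC1 : α₁ + α₂ ≠ 0) (hC2 : 2 * α₁ - α₂ ≠ 0) (hC3 : α₁ - 2 * α₂ ≠ 0)
    {a d e f : Fin 4} (had : a ≠ d) (hea : e ≠ a) (hed : e ≠ d) (hfa : f ≠ a) (hfd : f ≠ d)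
    {P Q R S : F × F}
    (hPQ : groupForm α₁ α₂ a P = groupForm α₁ α₂ a Q)
    (hRS : groupForm α₁ α₂ a R = groupForm α₁ α₂ a S)
    (hPR : groupForm α₁ α₂ d P = groupForm α₁ α₂ d R)
    (hQS : groupForm α₁ α₂ d Q = groupForm α₁ α₂ d S)
    (hPS : groupForm α₁ α₂ e P = groupForm α₁ α₂ e S)
    (hQR : groupForm α₁ α₂ f Q = groupForm α₁ α₂ f R) : P = S := by
  have hH := groupDet_harmonic_ne_zero hα₁ hα₂ hne h2 hC1 hC2 hC3 had hea hed hfa hfd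
  have hdet := groupDet_ne_zero hα₁ hα₂ hne had
  have cramer (c : Fin 4) (U : F × F) :
      groupDet α₁ α₂ a d * groupForm α₁ α₂ c U =
        groupDet α₁ α₂ c d * groupForm α₁ α₂ a U +
          groupDet α₁ α₂ a c * groupForm α₁ α₂ d U := by
    simp only [groupDet, groupForm]; ring
  have he : groupDet α₁ α₂ e d * (groupForm α₁ α₂ a S - groupForm α₁ α₂ a P) +
      groupDet α₁ α₂ a e * (groupForm α₁ α₂ d S - groupForm α₁ α₂ d P) = 0 := by
    linear_combination cramer e P - cramer e S - groupDet α₁ α₂ a d * hPS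
  have hf : groupDet α₁ α₂ f d * (groupForm α₁ α₂ a S - groupForm α₁ α₂ a P) -
      groupDet α₁ α₂ a f * (groupForm α₁ α₂ d S - groupForm α₁ α₂ d P) = 0 := by
    linear_combination cramer f Q - cramer f R - groupDet α₁ α₂ a d * hQR -
      groupDet α₁ α₂ f d * (hPQ + hRS) + groupDet α₁ α₂ a f * (hQS + hPR)
  have hX : groupForm α₁ α₂ a S - groupForm α₁ α₂ a P = 0 := by
    refine (mul_eq_zero.mp ?_).resolve_left hH
    linear_combination groupDet α₁ α₂ a f * he + groupDet α₁ α₂ a e * hf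
  have hY : groupForm α₁ α₂ d S - groupForm α₁ α₂ d P = 0 := by
    refine (mul_eq_zero.mp ?_).resolve_left hH
    linear_combination groupDet α₁ α₂ f d * he - groupDet α₁ α₂ e d * hf
  simp only [groupForm, groupDet] at hX hY hdet
  ext
  · refine mul_left_cancel₀ hdet ?_
    linear_combination (groupCoeff α₁ α₂ a).2 * hY - (groupCoeff α₁ α₂ d).2 * hX
  · refine mul_left_cancel₀ hdet ?_
    linear_combination (groupCoeff α₁ α₂ d).1 * hX - (groupCoeff α₁ α₂ a).1 * hY

/-- In a proper edge colouring of `K₄` with four colours, one of any two perfect matchings is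
monochromatic. -/
theorem monochromatic_matching_or (c : Fin 4 → Fin 4 → Fin 4)
    (hsymm : ∀ i j, i ≠ j → c i j = c j i)
    (hc : ∀ i j k, i ≠ j → i ≠ k → j ≠ k → c i j ≠ c i k)
    (i j k l : Fin 4) (hij : i ≠ j) (hik : i ≠ k) (hil : i ≠ l) (hjk : j ≠ k) (hjl : j ≠ l)
    (hkl : k ≠ l) : c i j = c k l ∨ c i k = c j l := by
  by_contra! h
  have pigeonhole : ¬ [c i j, c k l, c i k, c j l, c i l].Nodup := fun hnodup => by
    simpa using hnodup.length_le_card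
  have h1 := hc i j k hij hik hjk
  have h2 := hc i j l hij hil hjl
  have h3 := hc i k l hik hil hkl
  have h4 := hc j i l hij.symm hjl hil
  have h5 := hc k l i hkl hik.symm hil.symm
  have h6 := hc l k j hkl.symm hjl.symm hjk.symm
  have h7 := hc l k i hkl.symm hil.symm hik.symm
  have h8 := hc l j i hjl.symm hil.symm hij.symm
  rw [hsymm j i hij.symm] at h4
  rw [hsymm k i hik.symm] at h5
  rw [hsymm l k hkl.symm, hsymm l j hjl.symm] at h6
  rw [hsymm l k hkl.symm, hsymm l i hil.symm] at h7
  rw [hsymm l j hjl.symm, hsymm l i hil.symm] at h8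
  exact pigeonhole (by simp [h, h1, h2, h3, h4, h5, h6, h7, h8])

/-- A proper edge colouring of `K₄` with four colours has two monochromatic perfect
matchings. -/
theorem exists_two_monochromatic_matchings (c : Fin 4 → Fin 4 → Fin 4)
    (hsymm : ∀ i j, i ≠ j → c i j = c j i)
    (hc : ∀ i j k, i ≠ j → i ≠ k → j ≠ k → c i j ≠ c i k) :
    (c 0 1 = c 2 3 ∧ c 0 2 = c 1 3) ∨ (c 0 1 = c 2 3 ∧ c 0 3 = c 1 2) ∨
      (c 0 2 = c 1 3 ∧ c 0 3 = c 1 2) := by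
  have h1 := monochromatic_matching_or c hsymm hc 0 1 2 3 (by decide) (by decide) (by decide)
    (by decide) (by decide) (by decide)
  have h2 := monochromatic_matching_or c hsymm hc 0 1 3 2 (by decide) (by decide) (by decide)
    (by decide) (by decide) (by decide)
  have h3 := monochromatic_matching_or c hsymm hc 0 2 3 1 (by decide) (by decide) (by decide)
    (by decide) (by decide) (by decide)
  rw [hsymm 3 2 (by decide)] at h2
  rw [hsymm 3 1 (by decide), hsymm 2 1 (by decide)] at h3
  tauto

/-- If `char F ≠ 2`, `α₁ + α₂ ≠ 0`, `2·α₁ − α₂ ≠ 0` and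
`α₁ − 2·α₂ ≠ 0`, then the `𝓛_q^2`-TD contains no `(4,4)` absorbing set configuration:
there are no four pairwise distinct blocks pairwise intersecting in exactly one point
with the six intersection points pairwise distinct. -/
theorem ltd2_no_44_absorbing_set {F : Type*} [Field F] [Fintype F]
    (α₁ α₂ : F) (hα₁ : α₁ ≠ 0) (hα₂ : α₂ ≠ 0) (hne : α₁ ≠ α₂)
    (hchar : ringChar F ≠ 2)
    (hC1 : α₁ + α₂ ≠ 0) (hC2 : 2 * α₁ - α₂ ≠ 0) (hC3 : α₁ - 2 * α₂ ≠ 0) :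
    ¬ ∃ (b : Fin 4 → F × F) (pt : Fin 4 → Fin 4 → F × Fin 4),
        Function.Injective b ∧
        (∀ i j : Fin 4, i ≠ j →
            blk4 α₁ α₂ (b i) ∩ blk4 α₁ α₂ (b j) = {pt i j}) ∧
        (∀ i j k l : Fin 4, i < j → k < l → (i, j) ≠ (k, l) →
            pt i j ≠ pt k l) := by
  rintro ⟨b, pt, hb, hpt, hdist⟩
  have h2 : (2 : F) ≠ 0 := Ring.two_ne_zero hchar
  have hmem (i j : Fin 4) (hij : i ≠ j) :
      (pt i j).1 = groupForm α₁ α₂ (pt i j).2 (b i) ∧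
        (pt i j).1 = groupForm α₁ α₂ (pt i j).2 (b j) := by
    have h : pt i j ∈ blk4 α₁ α₂ (b i) ∩ blk4 α₁ α₂ (b j) := by
      rw [hpt i j hij]; rfl
    exact ⟨(mem_blk4_iff ..).mp h.1, (mem_blk4_iff ..).mp h.2⟩
  have hform (i j : Fin 4) (hij : i ≠ j) :
      groupForm α₁ α₂ (pt i j).2 (b i) = groupForm α₁ α₂ (pt i j).2 (b j) :=
    (hmem i j hij).1.symm.trans (hmem i j hij).2
  have hsymm (i j : Fin 4) (hij : i ≠ j) : pt i j = pt j i := by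
    rw [← Set.singleton_eq_singleton_iff, ← hpt i j hij, ← hpt j i hij.symm, Set.inter_comm]
  have hadj (i j k : Fin 4) (hij : i ≠ j) (hik : i ≠ k) (hjk : j ≠ k) : pt i j ≠ pt i k := by
    rcases lt_or_gt_of_ne hij with h | h <;> rcases lt_or_gt_of_ne hik with h' | h'
    · exact hdist i j i k h h' (by simp [hjk])
    · rw [hsymm i k hik]
      exact hdist i j k i h h' (by simp [hik])
    · rw [hsymm i j hij]
      exact hdist j i i k h h' (by simp [hij.symm])
    · rw [hsymm i j hij, hsymm i k hik]
      exact hdist j i k i h h' (by simp [hjk])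
  have hproper (i j k : Fin 4) (hij : i ≠ j) (hik : i ≠ k) (hjk : j ≠ k) :
      (pt i j).2 ≠ (pt i k).2 := by
    intro h
    refine hadj i j k hij hik hjk (Prod.ext ?_ h)
    rw [(hmem i j hij).1, (hmem i k hik).1, h]
  have key (i j k l : Fin 4) (hij : i ≠ j) (hik : i ≠ k) (hil : i ≠ l) (hjk : j ≠ k)
      (hjl : j ≠ l) (hkl : k ≠ l) (ha : (pt i j).2 = (pt k l).2)
      (hd : (pt i k).2 = (pt j l).2) : False := by
    refine hil (hb (eq_of_parallelogram hα₁ hα₂ hne h2 hC1 hC2 hC3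
      (hproper i j k hij hik hjk) (hproper i l j hil hij hjl.symm)
      (hproper i l k hil hik hkl.symm) (f := (pt j k).2) ?_ ?_ (hform i j hij)
      (ha ▸ hform k l hkl) (hform i k hik) (hd ▸ hform j l hjl) (hform i l hil)
      (hform j k hjk)))
    · rw [hsymm i j hij]
      exact hproper j k i hjk hij.symm hik.symm
    · rw [hd]
      exact hproper j k l hjk hjl hkl
  rcases exists_two_monochromatic_matchings (fun i j => (pt i j).2)
    (fun i j hij => congrArg Prod.snd (hsymm i j hij)) hproper with ⟨h, h'⟩ | ⟨h, h'⟩ | ⟨h, h'⟩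
  · exact key 0 1 2 3 (by decide) (by decide) (by decide) (by decide) (by decide) (by decide) h h'
  · exact key 0 1 3 2 (by decide) (by decide) (by decide) (by decide) (by decide) (by decide)
      (h.trans (congrArg Prod.snd (hsymm 2 3 (by decide)))) h'
  · exact key 0 2 3 1 (by decide) (by decide) (by decide) (by decide) (by decide) (by decide)
      (h.trans (congrArg Prod.snd (hsymm 1 3 (by decide))))
      (h'.trans (congrArg Prod.snd (hsymm 1 2 (by decide))))
end

section
/- Let F_q be a finite field and let α_1, α_2 be distinct nonzero elements of F_q such that char F_q ≠ 2 or α_1² + α_1·α_2 + α_2² ≠ 0. Then in the L_q^2-TD every nonempty collection of at most six distinct blocks contains a point lying in an odd number of the chosen blocks; equivalently, the column-weight-4 TD LDPC code of the design has no nonzero codeword of weight at most 6, so its minimum distance exceeds 6. -/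
open scoped Classical

/-- The `i`-th coordinate of the block with parameters `xy`: the unique first component of a
point of the block in the `i`-th group. -/
def blockCoord {F : Type*} [Field F] (a b : F) (i : Fin 4) (xy : F × F) : F :=
  ![xy.1, xy.2, a * xy.1 + xy.2, b * xy.1 + xy.2] i

lemma mem_blk4_iff_s13 {F : Type*} [Field F] (a b v : F) (i : Fin 4) (xy : F × F) :
    (v, i) ∈ blk4 a b xy ↔ blockCoord a b i xy = v := by
  fin_cases i <;> simp [blk4, blockCoord, eq_comm]

/-- Two distinct blocks meet in at most one point. -/
lemma eq_of_blockCoord_eq {F : Type*} [Field F] {a b : F} (ha : a ≠ 0) (hb : b ≠ 0)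
    (hab : a ≠ b) {i j : Fin 4} (hij : i ≠ j) {p q : F × F}
    (hi : blockCoord a b i p = blockCoord a b i q)
    (hj : blockCoord a b j p = blockCoord a b j q) : p = q := by
  obtain ⟨x, y⟩ := p
  obtain ⟨z, w⟩ := q
  have hab' : a - b ≠ 0 := sub_ne_zero.mpr hab
  fin_cases i <;> fin_cases j <;> simp [blockCoord] at hij hi hj ⊢ <;> grind

/-- In an even set of at most six blocks, every point of a block lies in exactly two blocks, and
the set has exactly six blocks. -/
lemma card_fiber_eq_two {α β : Type*} (f : Fin 4 → α → β)
    (hf : ∀ i j, i ≠ j → ∀ p q, f i p = f i q → f j p = f j q → p = q)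
    (S : Finset α) (hS : S.card ≤ 6)
    (heven : ∀ i v, Even (S.filter fun p => f i p = v).card) {p : α} (hp : p ∈ S) :
    S.card = 6 ∧ ∀ i, (S.filter fun q => f i q = f i p).card = 2 := by
  have hdisj : ∀ i ∈ (Finset.univ : Finset (Fin 4)), ∀ j ∈ (Finset.univ : Finset (Fin 4)),
      i ≠ j → Disjoint ((S.filter fun q => f i q = f i p).erase p)
        ((S.filter fun q => f j q = f j p).erase p) := by
    intro i _ j _ hij
    rw [Finset.disjoint_left]
    intro q hq hq'
    simp only [Finset.mem_erase, Finset.mem_filter] at hq hq'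
    exact hq.1 (hf i j hij q p hq.2.2 hq'.2.2)
  have hsub : (Finset.univ.biUnion fun i : Fin 4 => (S.filter fun q => f i q = f i p).erase p)
      ⊆ S.erase p := by
    intro q
    simp only [Finset.mem_biUnion, Finset.mem_erase, Finset.mem_filter]
    tauto
  have hcard := Finset.card_le_card hsub
  rw [Finset.card_biUnion hdisj, Finset.card_erase_of_mem hp, Fin.sum_univ_four] at hcard
  have hmem : ∀ i, p ∈ S.filter fun q => f i q = f i p := fun i => by simp [hp]
  have hpos : ∀ i, 0 < (S.filter fun q => f i q = f i p).card := fun i =>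
    Finset.card_pos.mpr ⟨p, hmem i⟩
  simp only [Finset.card_erase_of_mem (hmem _)] at hcard
  have hSeven : Even S.card := by
    rw [Finset.card_eq_sum_card_image (f 0) S]
    exact Finset.even_sum _ fun v _ => heven 0 v
  have e0 := heven 0 (f 0 p)
  have e1 := heven 1 (f 1 p)
  have e2 := heven 2 (f 2 p)
  have e3 := heven 3 (f 3 p)
  have h0 := hpos 0
  have h1 := hpos 1
  have h2 := hpos 2
  have h3 := hpos 3
  rw [Nat.even_iff] at hSeven e0 e1 e2 e3
  refine ⟨by omega, fun i => ?_⟩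
  fin_cases i <;> simp only [Fin.zero_eta, Fin.mk_one, Fin.reduceFinMk] <;> omega

/-- A function that is exactly two-to-one on six elements and identifies `p` and `p₁` pairs up the
other four elements. -/
lemma pairing_of_two_to_one {α β : Type*} (f : α → β) {S : Finset α}
    (htwo : ∀ p ∈ S, (S.filter fun q => f q = f p).card = 2) {p p₁ p₂ p₃ p₄ q : α}
    (hS : ∀ r, r ∈ S ↔ r = p ∨ r = p₁ ∨ r = p₂ ∨ r = p₃ ∨ r = p₄ ∨ r = q)
    (hnd : [p, p₁, p₂, p₃, p₄, q].Nodup) (h : f p₁ = f p) :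
    (f q = f p₂ ∧ f p₃ = f p₄) ∨ (f q = f p₃ ∧ f p₂ = f p₄) ∨ (f q = f p₄ ∧ f p₂ = f p₃) := by
  have hex : ∀ r ∈ S, ∃ s ∈ S, s ≠ r ∧ f s = f r := by
    intro r hr
    obtain ⟨s, hs, hsr⟩ := Finset.exists_mem_ne (by rw [htwo r hr]; norm_num) r
    rw [Finset.mem_filter] at hs
    exact ⟨s, hs.1, hsr, hs.2⟩
  have huniq : ∀ r ∈ S, ∀ s ∈ S, ∀ t ∈ S, r ≠ s → r ≠ t → f s = f r → f t = f r → s = t := by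
    intro r hr s hs t ht hrs hrt hfs hft
    by_contra hst
    have hle : ({r, s, t} : Finset α).card ≤ (S.filter fun q => f q = f r).card := by
      apply Finset.card_le_card
      intro u hu
      simp only [Finset.mem_insert, Finset.mem_singleton] at hu
      rcases hu with rfl | rfl | rfl <;> simp only [Finset.mem_filter] <;> tauto
    rw [htwo r hr, Finset.card_eq_three.mpr ⟨r, s, t, hrs, hrt, hst, rfl⟩] at hle
    omega
  have m := (hS p).2 (by simp)
  have m₁ := (hS p₁).2 (by simp)
  have m₂ := (hS p₂).2 (by simp)
  have m₃ := (hS p₃).2 (by simp)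
  have m₄ := (hS p₄).2 (by simp)
  have mq := (hS q).2 (by simp)
  simp only [List.nodup_cons, List.mem_cons, List.not_mem_nil, or_false, not_or,
    List.nodup_nil, not_false_eq_true, and_true] at hnd
  obtain ⟨⟨n01, n02, n03, n04, n0q⟩, ⟨n12, n13, n14, n1q⟩, ⟨n23, n24, n2q⟩, ⟨n34, n3q⟩, n4q⟩ := hnd
  have hout : ∀ r ∈ S, p ≠ r → p₁ ≠ r → f p ≠ f r := fun r hr h0 h1 h2 =>
    h1 (huniq p m p₁ m₁ r hr n01 h0 h h2.symm)
  have hpart : ∀ r ∈ S, p ≠ r → p₁ ≠ r →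
      ∃ s, (s = p₂ ∨ s = p₃ ∨ s = p₄ ∨ s = q) ∧ s ≠ r ∧ f s = f r := by
    intro r hr h0 h1
    obtain ⟨s, hs, hne, hfs⟩ := hex r hr
    rcases (hS s).1 hs with e | e | e
    · exact absurd (e ▸ hfs) (hout r hr h0 h1)
    · exact absurd (h.symm.trans (e ▸ hfs)) (hout r hr h0 h1)
    · exact ⟨s, e, hne, hfs⟩
  have v₂₃ : ¬(f p₂ = f q ∧ f p₃ = f q) := fun hh =>
    n23 (huniq q mq p₂ m₂ p₃ m₃ (Ne.symm n2q) (Ne.symm n3q) hh.1 hh.2)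
  have v₂₄ : ¬(f p₂ = f q ∧ f p₄ = f q) := fun hh =>
    n24 (huniq q mq p₂ m₂ p₄ m₄ (Ne.symm n2q) (Ne.symm n4q) hh.1 hh.2)
  have v₃₄ : ¬(f p₃ = f q ∧ f p₄ = f q) := fun hh =>
    n34 (huniq q mq p₃ m₃ p₄ m₄ (Ne.symm n3q) (Ne.symm n4q) hh.1 hh.2)
  have w₂ : f p₃ = f p₂ ∨ f p₄ = f p₂ ∨ f q = f p₂ := by
    obtain ⟨s, e | e | e | e, hne, hfs⟩ := hpart p₂ m₂ n02 n12 <;> rw [e] at hne hfs <;>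
      first | exact absurd rfl hne | simp [hfs]
  have w₃ : f p₂ = f p₃ ∨ f p₄ = f p₃ ∨ f q = f p₃ := by
    obtain ⟨s, e | e | e | e, hne, hfs⟩ := hpart p₃ m₃ n03 n13 <;> rw [e] at hne hfs <;>
      first | exact absurd rfl hne | simp [hfs]
  have w₄ : f p₂ = f p₄ ∨ f p₃ = f p₄ ∨ f q = f p₄ := by
    obtain ⟨s, e | e | e | e, hne, hfs⟩ := hpart p₄ m₄ n04 n14 <;> rw [e] at hne hfs <;>
      first | exact absurd rfl hne | simp [hfs]
  have wq : f p₂ = f q ∨ f p₃ = f q ∨ f p₄ = f q := by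
    obtain ⟨s, e | e | e | e, hne, hfs⟩ := hpart q mq n0q n1q <;> rw [e] at hne hfs <;>
      first | exact absurd rfl hne | simp [hfs]
  clear hS hex huniq hout hpart htwo
  grind

/-- An even set of six blocks forces characteristic two and `a ^ 2 + a * b + b ^ 2 = 0`. -/
lemma even_six_blocks {F : Type*} [Field F] {a b : F} (ha : a ≠ 0) (hb : b ≠ 0) (hab : a ≠ b)
    (S : Finset (F × F)) (hne : S.Nonempty) (hcard : S.card ≤ 6)
    (heven : ∀ i v, Even (S.filter fun p => blockCoord a b i p = v).card) :
    (2 : F) = 0 ∧ a ^ 2 + a * b + b ^ 2 = 0 := by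
  have hinj : ∀ i j, i ≠ j → ∀ p q, blockCoord a b i p = blockCoord a b i q →
      blockCoord a b j p = blockCoord a b j q → p = q :=
    fun i j hij p q => eq_of_blockCoord_eq ha hb hab hij
  have htwo : ∀ i, ∀ p ∈ S, (S.filter fun q => blockCoord a b i q = blockCoord a b i p).card = 2 :=
    fun i p hp => (card_fiber_eq_two _ hinj S hcard heven hp).2 i
  obtain ⟨p, hp⟩ := hne
  have hsix := (card_fiber_eq_two _ hinj S hcard heven hp).1
  have hex : ∀ i, ∃ s ∈ S, s ≠ p ∧ blockCoord a b i s = blockCoord a b i p := by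
    intro i
    obtain ⟨s, hs, hsr⟩ := Finset.exists_mem_ne (by rw [htwo i p hp]; norm_num) p
    rw [Finset.mem_filter] at hs
    exact ⟨s, hs.1, hsr, hs.2⟩
  choose g hgS hgp hg using hex
  have hgne : ∀ i j, i ≠ j → g i ≠ g j := fun i j hij h =>
    hgp i (hinj i j hij _ _ (hg i) (h ▸ hg j))
  have hnd5 : [p, g 0, g 1, g 2, g 3].Nodup := by
    simp [hgne, (hgp _).symm]
  obtain ⟨q, hq, hq5⟩ : ∃ q ∈ S, q ∉ [p, g 0, g 1, g 2, g 3].toFinset := by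
    apply Finset.exists_mem_notMem_of_card_lt_card
    rw [List.toFinset_card_of_nodup hnd5, hsix]
    simp
  simp only [List.mem_toFinset, List.mem_cons, List.not_mem_nil, or_false, not_or] at hq5
  obtain ⟨hqp, q₀, q₁, q₂, q₃⟩ := hq5
  have hpq : p ≠ q := Ne.symm hqp
  have hpg : ∀ i, p ≠ g i := fun i => (hgp i).symm
  have hgq : ∀ i, g i ≠ q := by
    intro i
    fin_cases i <;> apply Ne.symm <;> assumption
  have hnd : [p, g 0, g 1, g 2, g 3, q].Nodup := by simp [hpq, hpg, hgq, hgne]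
  have hS : ∀ r, r ∈ S ↔ r = p ∨ r = g 0 ∨ r = g 1 ∨ r = g 2 ∨ r = g 3 ∨ r = q := by
    have hsub : [p, g 0, g 1, g 2, g 3, q].toFinset ⊆ S := by
      intro r hr
      simp only [List.mem_toFinset, List.mem_cons, List.not_mem_nil, or_false] at hr
      rcases hr with rfl | rfl | rfl | rfl | rfl | rfl <;> simp only [hp, hgS, hq]
    have heq := Finset.eq_of_subset_of_card_le hsub
      (by rw [List.toFinset_card_of_nodup hnd, hsix]; simp)
    intro r
    rw [← heq]
    simp
  have c₀ := pairing_of_two_to_one _ (htwo 0) hS hnd (hg 0)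
  have c₁ := pairing_of_two_to_one (p₁ := g 1) (p₂ := g 0) (p₃ := g 2) (p₄ := g 3) (q := q) _
    (htwo 1) (fun r => by rw [hS]; clear * -; grind) (by simp [hpq, hpg, hgq, hgne]) (hg 1)
  have c₂ := pairing_of_two_to_one (p₁ := g 2) (p₂ := g 0) (p₃ := g 1) (p₄ := g 3) (q := q) _
    (htwo 2) (fun r => by rw [hS]; clear * -; grind) (by simp [hpq, hpg, hgq, hgne]) (hg 2)
  have c₃ := pairing_of_two_to_one (p₁ := g 3) (p₂ := g 0) (p₃ := g 1) (p₄ := g 2) (q := q) _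
    (htwo 3) (fun r => by rw [hS]; clear * -; grind) (by simp [hpq, hpg, hgq, hgne]) (hg 3)
  have n₀₁ := hgne 0 1 (by decide)
  have n₀₂ := hgne 0 2 (by decide)
  have n₀₃ := hgne 0 3 (by decide)
  have n₁₂ := hgne 1 2 (by decide)
  have n₁₃ := hgne 1 3 (by decide)
  have n₂₃ := hgne 2 3 (by decide)
  have hdir : ∀ i j, i ≠ j → ∀ p q, p ≠ q → blockCoord a b i p = blockCoord a b i q →
      blockCoord a b j p = blockCoord a b j q → False :=
    fun i j hij p q hpq hi hj => hpq (hinj i j hij p q hi hj)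
  have hx : (g 2).1 ≠ p.1 := fun h => hdir 0 2 (by decide) _ _ (hgp 2) h (hg 2)
  have e₀ := hg 0
  have e₁ := hg 1
  have e₂ := hg 2
  have e₃ := hg 3
  clear hinj htwo hS hnd hnd5 heven hg hgne hgS hgp hpq hpg hgq hqp
  generalize hB : blockCoord a b = B at *
  rcases c₀ with c₀ | c₀ | c₀ <;> rcases c₁ with c₁ | c₁ | c₁ <;>
    first
    | exact (hdir 0 1 (by decide) _ _ (by assumption) c₀.1 c₁.1).elim
    | exact (hdir 0 1 (by decide) _ _ (by assumption) c₀.2 c₁.2).elim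
    | skip
  all_goals
  rcases c₂ with c₂ | c₂ | c₂ <;>
    first
    | exact (hdir 0 2 (by decide) _ _ (by assumption) c₀.1 c₂.1).elim
    | exact (hdir 0 2 (by decide) _ _ (by assumption) c₀.2 c₂.2).elim
    | exact (hdir 1 2 (by decide) _ _ (by assumption) c₁.1 c₂.1).elim
    | exact (hdir 1 2 (by decide) _ _ (by assumption) c₁.2 c₂.2).elim
    | skip
  all_goals
  rcases c₃ with c₃ | c₃ | c₃ <;>
    first
    | exact (hdir 0 3 (by decide) _ _ (by assumption) c₀.1 c₃.1).elim
    | exact (hdir 0 3 (by decide) _ _ (by assumption) c₀.2 c₃.2).elim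
    | exact (hdir 1 3 (by decide) _ _ (by assumption) c₁.1 c₃.1).elim
    | exact (hdir 1 3 (by decide) _ _ (by assumption) c₁.2 c₃.2).elim
    | exact (hdir 2 3 (by decide) _ _ (by assumption) c₂.1 c₃.1).elim
    | skip
  all_goals
    subst hB
    clear hdir n₀₁ n₀₂ n₀₃ n₁₂ n₁₃ n₂₃ q₀ q₁ q₂ q₃
    generalize g 0 = r₀ at *
    generalize g 1 = r₁ at *
    generalize g 2 = r₂ at *
    generalize g 3 = r₃ at *
    simp only [blockCoord, Matrix.cons_val] at c₀ c₁ c₂ c₃ e₀ e₁ e₂ e₃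
    grind

/-- If `char F ≠ 2` or `α₁² + α₁·α₂ + α₂² ≠ 0`, then in the
`𝓛_q^2`-TD every nonempty collection of at most six distinct blocks contains a point of
odd degree; equivalently, the column-weight-4 TD LDPC code has no nonzero codeword of
weight at most `6`, i.e. its minimum distance exceeds `6`. -/
theorem ltd2_min_distance_gt_six {F : Type*} [Field F] [Fintype F]
    (α₁ α₂ : F) (hα₁ : α₁ ≠ 0) (hα₂ : α₂ ≠ 0) (hne : α₁ ≠ α₂)
    (hC : ringChar F ≠ 2 ∨ α₁ ^ 2 + α₁ * α₂ + α₂ ^ 2 ≠ 0) :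
    -- every nonempty collection of at most six blocks has a point of odd degree
    (∀ S : Finset (F × F), S.Nonempty → S.card ≤ 6 →
        ∃ p : F × Fin 4, Odd ((S.filter fun xy => p ∈ blk4 α₁ α₂ xy).card)) ∧
    -- equivalently: the TD LDPC code has no nonzero codeword of weight at most 6
    (∀ c : F × F → ZMod 2,
        (∀ p : F × Fin 4,
            (∑ xy : F × F, if p ∈ blk4 α₁ α₂ xy then c xy else 0) = 0) →
        c ≠ 0 → 6 < (Finset.univ.filter fun xy : F × F => c xy ≠ 0).card) := by
  have hodd : ∀ S : Finset (F × F), S.Nonempty → S.card ≤ 6 →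
      ∃ p : F × Fin 4, Odd ((S.filter fun xy => p ∈ blk4 α₁ α₂ xy).card) := by
    intro S hS hcard
    by_contra! h
    obtain ⟨h2, hq⟩ := even_six_blocks hα₁ hα₂ hne S hS hcard fun i v => by
      simpa only [mem_blk4_iff_s13, Nat.not_odd_iff_even] using h (v, i)
    refine hC.elim (fun hchar => ?_) (fun hne' => hne' hq)
    exact Ring.two_ne_zero hchar h2
  refine ⟨hodd, fun c hc hc0 => ?_⟩
  by_contra! hcard
  obtain ⟨x, hx⟩ := Function.ne_iff.mp hc0
  obtain ⟨p, hp⟩ := hodd _ ⟨x, by simpa using hx⟩ hcard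
  have hone : ∀ z : ZMod 2, z = if z ≠ 0 then 1 else 0 := by decide
  have hsum := hc p
  rw [← Finset.sum_filter, Finset.sum_congr rfl fun xy _ => hone (c xy), Finset.sum_boole,
    Finset.filter_filter] at hsum
  rw [Finset.filter_filter] at hp
  simp only [and_comm] at hp hsum
  rw [ZMod.natCast_eq_zero_iff_even] at hsum
  exact Nat.not_even_iff_odd.mpr hp hsum
end

section
/- Let F_q be a finite field with char F_q ≠ 2 and let α be a nonzero element of F_q. Then in the L_q^1-TD there do not exist four pairwise distinct blocks such that every point lies in an even number of the four blocks; equivalently, the column-weight-3 TD LDPC code of the design has no codeword of weight 4, so the (4,0) fully absorbing sets are eliminated. -/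
open scoped Classical

/-- The block `B(x,y)` of the `𝓛_q^1`-TD with scale factor `α`:
`B(x,y) = {(x,1), (y,2), (α·x+y,3)}`, the three groups being indexed by `Fin 3`. -/
def blk3 {F : Type*} [Field F] (α : F) (xy : F × F) : Set (F × Fin 3) :=
  {(xy.1, (0 : Fin 3)), (xy.2, (1 : Fin 3)), (α * xy.1 + xy.2, (2 : Fin 3))}

/-- If all fibres of `f` on a finite set are even, every element of the set shares its value
with another one. -/
theorem exists_ne_of_even_fibers {X Y : Type*} (S : Finset X) (f : X → Y)
    (h : ∀ y, Even (S.filter fun x => f x = y).card) {a : X} (ha : a ∈ S) :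
    ∃ b ∈ S, b ≠ a ∧ f b = f a := by
  have hmem : a ∈ S.filter fun x => f x = f a := by simp [ha]
  have hpos := Finset.card_pos.mpr ⟨a, hmem⟩
  obtain ⟨k, hk⟩ := h (f a)
  have hcard : 1 < (S.filter fun x => f x = f a).card := by omega
  obtain ⟨b, hb, hba⟩ := Finset.exists_mem_ne hcard a
  rw [Finset.mem_filter] at hb
  exact ⟨b, hb.1, hba, hb.2⟩

/-- If all fibres of `f` on a four-element set are even, `f` is constant on both parts of some
partition of the set into two pairs. -/
theorem pairing_of_even_fibers {X Y : Type*} [DecidableEq X] (f : X → Y) {a b c d : X}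
    (h : ∀ y, Even (({a, b, c, d} : Finset X).filter fun x => f x = y).card) :
    (f a = f b ∧ f c = f d) ∨ (f a = f c ∧ f b = f d) ∨ (f a = f d ∧ f b = f c) := by
  have ha := exists_ne_of_even_fibers _ f h (a := a) (by simp)
  have hb := exists_ne_of_even_fibers _ f h (a := b) (by simp)
  have hc := exists_ne_of_even_fibers _ f h (a := c) (by simp)
  have hd := exists_ne_of_even_fibers _ f h (a := d) (by simp)
  simp only [Finset.mem_insert, Finset.mem_singleton] at ha hb hc hd
  grind

/-- If `char F ≠ 2`, then in the `𝓛_q^1`-TD there are no four pairwise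
distinct blocks such that every point lies in an even number of them; equivalently, the
column-weight-3 TD LDPC code has no codeword of weight `4`, so the `(4,0)` fully
absorbing sets are eliminated. -/
theorem ltd1_no_40_absorbing_set {F : Type*} [Field F] [Fintype F]
    (α : F) (hα : α ≠ 0) (hchar : ringChar F ≠ 2) :
    ¬ ∃ S : Finset (F × F), S.card = 4 ∧
        ∀ p : F × Fin 3, Even ((S.filter fun xy => p ∈ blk3 α xy).card) := by
  rintro ⟨S, hS, h⟩
  have h2 : (2 : F) ≠ 0 := Ring.two_ne_zero hchar
  obtain ⟨a, b, c, d, hab, hac, had, hbc, hbd, hcd, rfl⟩ := Finset.card_eq_four.mp hS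
  have hx := pairing_of_even_fibers (fun p : F × F => p.1) (a := a) (b := b) (c := c) (d := d)
    fun y => by simpa [blk3, eq_comm] using h (y, 0)
  have hy := pairing_of_even_fibers (fun p : F × F => p.2) (a := a) (b := b) (c := c) (d := d)
    fun y => by simpa [blk3, eq_comm] using h (y, 1)
  have hz := pairing_of_even_fibers (fun p : F × F => α * p.1 + p.2)
    (a := a) (b := b) (c := c) (d := d)
    fun y => by simpa [blk3, eq_comm] using h (y, 2)
  clear h hS
  obtain ⟨a₁, a₂⟩ := a
  obtain ⟨b₁, b₂⟩ := b
  obtain ⟨c₁, c₂⟩ := c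
  obtain ⟨d₁, d₂⟩ := d
  simp only [ne_eq, Prod.mk.injEq] at *
  rcases hx with ⟨rfl, rfl⟩ | ⟨rfl, rfl⟩ | ⟨rfl, rfl⟩ <;>
  rcases hy with ⟨rfl, rfl⟩ | ⟨rfl, rfl⟩ | ⟨rfl, rfl⟩ <;>
  grind
end
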